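/- Every generalized pattern is a fixed point of the pattern map: for every t ∈ T_n (viewed as a vector of natural numbers), Ψ(t) = t. Consequently Ψ is idempotent: Ψ(Ψ(x)) = Ψ(x) for every real vector x of length n. -/

import Mathlib

/-- The generalized ordinal pattern of a vector `x` in a linear order:
`Ψ(x)_j` is the number of distinct values attained by `x` that are `≤ x_j`. -/
def pattern {α : Type*} [LinearOrder α] {n : ℕ} (x : Fin n → α) : Fin n → ℕ :=
  fun j => ((Finset.image x Finset.univ).filter (fun y => y ≤ x j)).card

/-- `t ∈ T_n`: the set of entries of `t` equals `{1, …, m}` for some `1 ≤ m ≤ n`. -/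
def IsPattern {n : ℕ} (t : Fin n → ℕ) : Prop :=
  ∃ m, 1 ≤ m ∧ m ≤ n ∧ Finset.image t Finset.univ = Finset.Icc 1 m

/-- The pattern map preserves and reflects the order of the entries. -/
theorem pattern_le_iff {α : Type*} [LinearOrder α] {n : ℕ} (x : Fin n → α) (i j : Fin n) :
    pattern x i ≤ pattern x j ↔ x i ≤ x j := by
  constructor
  · intro h
    by_contra hlt
    rw [not_le] at hlt
    refine absurd h (not_le.mpr ?_)
    unfold pattern
    apply Finset.card_lt_card
    rw [Finset.ssubset_iff_of_subset]
    · exact ⟨x i, by simp, by simp [hlt]⟩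
    · intro y hy
      rw [Finset.mem_filter] at hy ⊢
      exact ⟨hy.1, hy.2.trans hlt.le⟩
  · intro h
    unfold pattern
    apply Finset.card_le_card
    intro y hy
    rw [Finset.mem_filter] at hy ⊢
    exact ⟨hy.1, hy.2.trans h⟩

/-- every generalized pattern is a fixed point of the pattern map
(`Ψ(t) = t` for `t ∈ T_n`), and consequently `Ψ` is idempotent on real vectors. -/
theorem pattern_fixed_and_idempotent (n : ℕ) :
    (∀ t : Fin n → ℕ, IsPattern t → pattern t = t) ∧
    (∀ x : Fin n → ℝ, pattern (pattern x) = pattern x) := by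
  refine ⟨?_, ?_⟩
  · rintro t ⟨m, -, -, hm⟩
    funext j
    have hj : t j ∈ Finset.Icc 1 m := by
      rw [← hm]
      simp
    rw [Finset.mem_Icc] at hj
    have h : (Finset.Icc 1 m).filter (fun y => y ≤ t j) = Finset.Icc 1 (t j) := by
      ext y
      simp only [Finset.mem_filter, Finset.mem_Icc]
      omega
    unfold pattern
    rw [hm, h]
    simp
  · intro x
    funext j
    symm
    change ((Finset.image x Finset.univ).filter (fun y => y ≤ x j)).card =
      ((Finset.image (pattern x) Finset.univ).filter (fun y => y ≤ pattern x j)).card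
    let r : ℝ → ℕ := fun a => ((Finset.image x Finset.univ).filter (fun y => y ≤ a)).card
    have hr : ∀ i, r (x i) = pattern x i := fun i => rfl
    refine Finset.card_bij (fun a _ => r a) ?_ ?_ ?_
    · intro a ha
      simp only [Finset.mem_filter, Finset.mem_image, Finset.mem_univ, true_and] at ha ⊢
      obtain ⟨⟨i, rfl⟩, hi⟩ := ha
      exact ⟨⟨i, rfl⟩, (pattern_le_iff x i j).2 hi⟩
    · intro a ha b hb hab
      simp only [Finset.mem_filter, Finset.mem_image, Finset.mem_univ, true_and] at ha hb
      obtain ⟨⟨i, rfl⟩, -⟩ := ha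
      obtain ⟨⟨k, rfl⟩, -⟩ := hb
      exact le_antisymm ((pattern_le_iff x i k).1 (le_of_eq hab))
        ((pattern_le_iff x k i).1 (ge_of_eq hab))
    · intro b hb
      simp only [Finset.mem_filter, Finset.mem_image, Finset.mem_univ, true_and] at hb
      obtain ⟨⟨i, rfl⟩, hi⟩ := hb
      refine ⟨x i, ?_, hr i⟩
      simp only [Finset.mem_filter, Finset.mem_image, Finset.mem_univ, true_and]
      exact ⟨⟨i, rfl⟩, (pattern_le_iff x i j).1 hi⟩
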